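/- (Theorem 2 decomposition: second moment of the real part of the QPSK success-conditioned noise.) Let Ω > 0, σ > 0, λ_i > 0, λ_j > 0, set γ̄ = Ω/σ², χ_j = λ_j/σ, μ_i = √(λ_i²γ̄/(λ_i²γ̄+2)), μ_j = √(λ_j²γ̄/(λ_j²γ̄+2)), ϖ₁ = χ_j/(λ_i μ_j), ϖ₂ = −χ_j/λ_i, and define Ψ(a,b) = ∫_{-∞}^0 w² (1/(a√(2π))) e^{-w²/(2a²)} Φ(bw) dw. Let g(w) = f_N(w)·(1+μ_j)/2 for w ≥ 0 and g(w) = f_N(w)·[μ_j Φ(ϖ₁ w) + e^{-w²/(λ_i²Ω)} Φ(ϖ₂ w)] for w < 0 be the unnormalized marginal density of the real part W_R of the success-conditioned QPSK noise. Then ∫_{-∞}^∞ w² g(w) dw = σ²(1+μ_j)/4 + μ_j·Ψ(σ, ϖ₁) + μ_i·Ψ(σ μ_i, ϖ₂). Consequently, p_S·E[W_R²] equals the right-hand side, and E[|W|²] = 2 E[W_R²] by the symmetry of the QPSK constellation. -/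

import Mathlib

open MeasureTheory Real Filter Set

noncomputable def Phi (x : ℝ) : ℝ :=
  ∫ t in Set.Iic x, (Real.sqrt (2 * Real.pi))⁻¹ * Real.exp (-t ^ 2 / 2)

noncomputable def Q (x : ℝ) : ℝ := 1 - Phi x

noncomputable def gaussPDF (σ n : ℝ) : ℝ :=
  (σ * Real.sqrt (2 * Real.pi))⁻¹ * Real.exp (-n ^ 2 / (2 * σ ^ 2))

noncomputable def E1 (x : ℝ) : ℝ := ∫ t in Set.Ioi x, Real.exp (-t) / t


noncomputable def Psi (a b : ℝ) : ℝ :=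
  ∫ w in Set.Iic (0:ℝ),
    w ^ 2 * ((a * Real.sqrt (2 * Real.pi))⁻¹ * Real.exp (-w ^ 2 / (2 * a ^ 2))) * Phi (b * w)

lemma aux_phi_int : Integrable (fun t : ℝ => (Real.sqrt (2 * Real.pi))⁻¹ * Real.exp (-t ^ 2 / 2)) := by
  have h := (integrable_exp_neg_mul_sq (b := 1/2) (by norm_num)).const_mul (Real.sqrt (2 * Real.pi))⁻¹
  refine h.congr (Eventually.of_forall fun t => ?_)
  simp only
  congr 2
  ring

lemma aux_phi_mono : Monotone Phi := by
  intro x y hxy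
  unfold Phi
  refine setIntegral_mono_set aux_phi_int.integrableOn ?_ ?_
  · exact Eventually.of_forall fun t => by simp only [Pi.zero_apply]; positivity
  · exact (Iic_subset_Iic.mpr hxy).eventuallyLE

lemma aux_phi_bound : ∃ C : ℝ, ∀ x, ‖Phi x‖ ≤ C := by
  refine ⟨∫ t : ℝ, (Real.sqrt (2 * Real.pi))⁻¹ * Real.exp (-t ^ 2 / 2), fun x => ?_⟩
  have h0 : 0 ≤ Phi x := by
    unfold Phi
    exact integral_nonneg fun t => by simp only [Pi.zero_apply]; positivity
  rw [Real.norm_of_nonneg h0]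
  exact setIntegral_le_integral aux_phi_int (Eventually.of_forall fun t => by
    simp only [Pi.zero_apply]; positivity)

lemma aux_int (a : ℝ) (ha : 0 < a) : Integrable (fun w : ℝ =>
    w ^ 2 * ((a * Real.sqrt (2 * Real.pi))⁻¹ * Real.exp (-w ^ 2 / (2 * a ^ 2)))) := by
  have h := (integrable_rpow_mul_exp_neg_mul_sq (b := 1/(2*a^2)) (by positivity)
    (s := 2) (by norm_num)).const_mul (a * Real.sqrt (2 * Real.pi))⁻¹
  refine h.congr (Eventually.of_forall fun t => ?_)
  simp only [Real.rpow_two]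
  rw [show -(1/(2*a^2)) * t^2 = -t ^ 2 / (2 * a ^ 2) by ring]
  ring

lemma aux_int_phi (a b : ℝ) (ha : 0 < a) : Integrable (fun w : ℝ =>
    w ^ 2 * ((a * Real.sqrt (2 * Real.pi))⁻¹ * Real.exp (-w ^ 2 / (2 * a ^ 2))) * Phi (b * w)) := by
  obtain ⟨C, hC⟩ := aux_phi_bound
  refine (aux_int a ha).mul_bdd (c := C) ?_ (Eventually.of_forall fun x => hC _)
  exact (aux_phi_mono.measurable.comp (measurable_const.mul measurable_id)).aestronglyMeasurable

lemma aux_val (a : ℝ) (ha : 0 < a) : ∫ w in Ioi (0:ℝ), w ^ 2 * gaussPDF a w = a ^ 2 / 2 := by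
  have h := integral_rpow_mul_exp_neg_mul_rpow (p := 2) (q := 2) (b := 1/(2*a^2))
    (by norm_num) (by norm_num) (by positivity)
  have hG : Real.Gamma ((2+1)/2) = √π / 2 := by
    rw [show ((2:ℝ)+1)/2 = 1/2 + 1 by norm_num, Real.Gamma_add_one (by norm_num),
      Real.Gamma_one_half_eq]
    ring
  have hb : (1/(2*a^2)) ^ (-(2+1)/2 : ℝ) = 2 * a^2 * (√2 * a) := by
    rw [show (-(2+1)/2 : ℝ) = -(1 + 1/2) by norm_num, Real.rpow_neg (by positivity),
      ← Real.inv_rpow (by positivity), one_div, inv_inv, Real.rpow_add (by positivity),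
      Real.rpow_one, ← Real.sqrt_eq_rpow, Real.sqrt_mul (by norm_num), Real.sqrt_sq ha.le]
  rw [hG, hb] at h
  have e : ∀ w : ℝ, w ^ 2 * gaussPDF a w
      = (a * Real.sqrt (2 * Real.pi))⁻¹ * (w ^ (2:ℝ) * Real.exp (-(1/(2*a^2)) * w ^ (2:ℝ))) := by
    intro w
    simp only [Real.rpow_two, gaussPDF]
    rw [show -(1/(2*a^2)) * w^2 = -w ^ 2 / (2 * a ^ 2) by ring]
    ring
  simp_rw [e]
  rw [integral_const_mul, h, Real.sqrt_mul (by norm_num)]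
  have : √π ≠ 0 := by positivity
  field_simp

/-- Theorem 2 decomposition: second moment of the real part of the QPSK
success-conditioned noise, ∫ w² g(w) dw = σ²(1+μ_j)/4 + μ_j Ψ(σ,ϖ₁) + μ_i Ψ(σμ_i,ϖ₂),
and hence p_S·E[W_R²] equals the same right-hand side. -/
theorem qpsk_second_moment_decomposition (Ω σ li lj γbar χj μi μj w1 w2 pS : ℝ)
    (g : ℝ → ℝ)
    (hΩ : 0 < Ω) (hσ : 0 < σ) (hli : 0 < li) (hlj : 0 < lj)
    (hγ : γbar = Ω / σ ^ 2) (hχ : χj = lj / σ)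
    (hμi : μi = Real.sqrt (li ^ 2 * γbar / (li ^ 2 * γbar + 2)))
    (hμj : μj = Real.sqrt (lj ^ 2 * γbar / (lj ^ 2 * γbar + 2)))
    (hw1 : w1 = χj / (li * μj)) (hw2 : w2 = -χj / li)
    (hg : ∀ w, g w = if 0 ≤ w then gaussPDF σ w * (1 + μj) / 2
        else gaussPDF σ w *
          (μj * Phi (w1 * w) + Real.exp (-w ^ 2 / (li ^ 2 * Ω)) * Phi (w2 * w)))
    (hpS : 0 < pS) :
    (∫ w : ℝ, w ^ 2 * g w)
      = σ ^ 2 * (1 + μj) / 4 + μj * Psi σ w1 + μi * Psi (σ * μi) w2 ∧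
    pS * (∫ w : ℝ, w ^ 2 * (g w / pS))
      = σ ^ 2 * (1 + μj) / 4 + μj * Psi σ w1 + μi * Psi (σ * μi) w2 := by
  have hγ0 : 0 < γbar := by rw [hγ]; positivity
  have hμi0 : 0 < μi := by rw [hμi]; positivity
  have hμi2 : μi ^ 2 = li ^ 2 * γbar / (li ^ 2 * γbar + 2) := by
    rw [hμi, Real.sq_sqrt (by positivity)]
  have hexp : ∀ w : ℝ, -w ^ 2 / (2 * (σ * μi) ^ 2)
      = -w ^ 2 / (2 * σ ^ 2) + -w ^ 2 / (li ^ 2 * Ω) := by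
    intro w
    rw [mul_pow, hμi2, hγ]
    field_simp
    ring
  have e1 : ∀ w ∈ Ioi (0:ℝ), w ^ 2 * g w = (1 + μj) / 2 * (w ^ 2 * gaussPDF σ w) := by
    intro w hw
    rw [hg, if_pos (le_of_lt hw)]
    ring
  have e2 : ∀ w ∈ Iio (0:ℝ), w ^ 2 * g w =
      μj * (w ^ 2 * ((σ * Real.sqrt (2 * Real.pi))⁻¹ * Real.exp (-w ^ 2 / (2 * σ ^ 2))) * Phi (w1 * w))
      + μi * (w ^ 2 * (((σ * μi) * Real.sqrt (2 * Real.pi))⁻¹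
        * Real.exp (-w ^ 2 / (2 * (σ * μi) ^ 2))) * Phi (w2 * w)) := by
    intro w hw
    rw [hg, if_neg (not_le.mpr hw), hexp, Real.exp_add, gaussPDF]
    have : √(2 * π) ≠ 0 := by positivity
    field_simp
  have i1 := (aux_int_phi σ w1 hσ).const_mul μj
  have i2 := (aux_int_phi (σ * μi) w2 (by positivity)).const_mul μi
  have v2 : ∫ w in Iic (0:ℝ), w ^ 2 * g w = μj * Psi σ w1 + μi * Psi (σ * μi) w2 := by
    rw [integral_Iic_eq_integral_Iio, setIntegral_congr_fun measurableSet_Iio e2,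
      integral_add i1.integrableOn i2.integrableOn, integral_const_mul, integral_const_mul,
      Psi, Psi, integral_Iic_eq_integral_Iio, integral_Iic_eq_integral_Iio]
  have v1 : ∫ w in Ioi (0:ℝ), w ^ 2 * g w = σ ^ 2 * (1 + μj) / 4 := by
    rw [setIntegral_congr_fun measurableSet_Ioi e1, integral_const_mul, aux_val σ hσ]
    ring
  have I1 : IntegrableOn (fun w => w ^ 2 * g w) (Ioi 0) :=
    (((aux_int σ hσ).const_mul ((1 + μj) / 2)).integrableOn).congr_fun
      (fun w hw => (e1 w hw).symm) measurableSet_Ioi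
  have I2 : IntegrableOn (fun w => w ^ 2 * g w) (Iic 0) := by
    rw [integrableOn_Iic_iff_integrableOn_Iio]
    exact ((i1.add i2).integrableOn).congr_fun
      (fun w hw => (e2 w hw).symm) measurableSet_Iio
  have main : (∫ w : ℝ, w ^ 2 * g w)
      = σ ^ 2 * (1 + μj) / 4 + μj * Psi σ w1 + μi * Psi (σ * μi) w2 := by
    rw [← intervalIntegral.integral_Iic_add_Ioi I2 I1, v1, v2]
    ring
  refine ⟨main, ?_⟩
  rw [← main, ← integral_const_mul]
  congr 1
  funext w
  field_simp
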